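/- Let X be a completely regular (Hausdorff) topological space and let H be a non-vanishing self-adjoint closed subalgebra of C_B(X) which separates points from closed sets in X, and let λ_H X = ⋃_{h∈H} Coz(h_α) ⊆ α_H X. Then for every h in H, the restriction h_λ of h_α to λ_H X vanishes at infinity on λ_H X; that is, for every ε > 0 the set {z ∈ λ_H X : |h_λ(z)| ≥ ε} is compact. In other words, h_λ belongs to C₀(λ_H X). -/

import Mathlib

open Set Topology

/-- `H ⊆ C_B(X)` separates points from closed sets in `X`. -/
def SeparatesPointsFromClosedSets {X : Type*} [TopologicalSpace X]
    (H : Set (BoundedContinuousFunction X ℂ)) : Prop :=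
  ∀ C : Set X, IsClosed C → ∀ x ∉ C, ∃ h ∈ H, h x ∉ closure ((h : X → ℂ) '' C)

/-- The evaluation map `e : X → ∏_{h ∈ H} cl_ℂ(h(X))`. -/
noncomputable def evalMap {X : Type*} [TopologicalSpace X]
    (H : Set (BoundedContinuousFunction X ℂ)) (x : X) :
    (h : H) → (closure (Set.range ((h : BoundedContinuousFunction X ℂ) : X → ℂ)) : Set ℂ) :=
  fun h => ⟨(h : BoundedContinuousFunction X ℂ) x, subset_closure ⟨x, rfl⟩⟩

/-- The compactification `α_H X`, as the closure of `e(X)` in the product. -/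
noncomputable def alphaSet {X : Type*} [TopologicalSpace X]
    (H : Set (BoundedContinuousFunction X ℂ)) :
    Set ((h : H) → (closure (Set.range ((h : BoundedContinuousFunction X ℂ) : X → ℂ)) : Set ℂ)) :=
  closure (Set.range (evalMap H))

/-- The corestriction `X → α_H X` of the evaluation map. -/
noncomputable def evalAlpha {X : Type*} [TopologicalSpace X]
    (H : Set (BoundedContinuousFunction X ℂ)) (x : X) : alphaSet H :=
  ⟨evalMap H x, subset_closure ⟨x, rfl⟩⟩

/-- The extension `h_α : α_H X → ℂ` of `h ∈ H`, i.e. the restriction to `α_H X` of the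
projection onto the `h`-th coordinate. -/
noncomputable def hAlpha {X : Type*} [TopologicalSpace X]
    (H : Set (BoundedContinuousFunction X ℂ)) (h : H) (z : alphaSet H) : ℂ :=
  (z.1 h : ℂ)

/-- The subspace `λ_H X = ⋃_{h ∈ H} Coz(h_α)` of `α_H X`. -/
noncomputable def lambdaSet {X : Type*} [TopologicalSpace X]
    (H : Set (BoundedContinuousFunction X ℂ)) : Set (alphaSet H) :=
  {z : alphaSet H | ∃ h : H, hAlpha H h z ≠ 0}

instance compactSpace_alphaSet {X : Type*} [TopologicalSpace X]
    (H : Set (BoundedContinuousFunction X ℂ)) : CompactSpace (alphaSet H) := by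
  have (h : H) : CompactSpace
      (closure (Set.range ((h : BoundedContinuousFunction X ℂ) : X → ℂ)) : Set ℂ) :=
    isCompact_iff_compactSpace.mp h.1.isBounded_range.isCompact_closure
  exact isCompact_iff_compactSpace.mp isClosed_closure.isCompact

theorem continuous_hAlpha {X : Type*} [TopologicalSpace X]
    (H : Set (BoundedContinuousFunction X ℂ)) (h : H) : Continuous (hAlpha H h) :=
  continuous_subtype_val.comp ((continuous_apply h).comp continuous_subtype_val)

/-- for every `h ∈ H`, the restriction `h_λ` of `h_α` to `λ_H X` vanishes at
infinity on `λ_H X`: for every `ε > 0` the set `{z ∈ λ_H X : |h_λ(z)| ≥ ε}` is compact. -/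
theorem hLambda_zero_at_infty {X : Type*} [TopologicalSpace X]
    [CompletelyRegularSpace X] [T2Space X]
    (H : NonUnitalStarSubalgebra ℂ (BoundedContinuousFunction X ℂ))
    (hclosed : IsClosed (H : Set (BoundedContinuousFunction X ℂ)))
    (hnv : ∀ x : X, ∃ h ∈ H, h x ≠ 0)
    (hsep : SeparatesPointsFromClosedSets (H : Set (BoundedContinuousFunction X ℂ))) :
    ∀ h : H, ∀ ε : ℝ, 0 < ε →
      IsCompact {z : lambdaSet (H : Set (BoundedContinuousFunction X ℂ)) |
        ε ≤ ‖hAlpha (H : Set (BoundedContinuousFunction X ℂ)) ⟨h.1, h.2⟩ z.1‖} := by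
  intro h ε hε
  have hK : IsCompact {z | ε ≤ ‖hAlpha (H : Set (BoundedContinuousFunction X ℂ)) ⟨h.1, h.2⟩ z‖} :=
    (isClosed_le continuous_const (continuous_hAlpha _ _).norm).isCompact
  refine IsInducing.subtypeVal.isCompact_preimage' hK fun z hz => ?_
  rw [Subtype.range_val]
  exact ⟨⟨h.1, h.2⟩, norm_pos_iff.mp (hε.trans_le hz)⟩
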